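/- Let F be a long-tailed distribution function on ℝ and let T be an almost surely nonpositive real random variable with E[−T] < ∞. Then F̄_s(x) − E[F̄_s(x − T)] ∼ E[−T] · F̄(x) as x → ∞; that is, lim_{x→∞} (F̄_s(x) − E[F̄_s(x − T)])/F̄(x) = E[−T]. -/

import Mathlib

open MeasureTheory ProbabilityTheory Filter Set

noncomputable section

/-- The integrated tail `F̄_s(x) = ∫_x^∞ (1 - F(u)) du` of a distribution function `F`. -/
def tailFs (F : ℝ → ℝ) (x : ℝ) : ℝ := ∫ u in Set.Ioi x, (1 - F u)

/-- `F` is long-tailed: `F̄(x) > 0` everywhere and `F̄(x+t)/F̄(x) → 1` as `x → ∞`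
for every fixed `t`. -/
def LongTailed (F : ℝ → ℝ) : Prop :=
  (∀ x, 0 < 1 - F x) ∧
    ∀ t : ℝ, Tendsto (fun x => (1 - F (x + t)) / (1 - F x)) atTop (nhds 1)

/-- `F` belongs to the class `S*` of strong subexponential distribution functions:
`a₊ = ∫_0^∞ F̄(y) dy ∈ (0,∞)` and `∫_0^x F̄(x-y) F̄(y) dy ∼ 2 a₊ F̄(x)` as `x → ∞`. -/
def StrongSubexp (F : ℝ → ℝ) : Prop :=
  IntegrableOn (fun y => 1 - F y) (Set.Ioi (0:ℝ)) ∧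
  (0 < ∫ y in Set.Ioi (0:ℝ), (1 - F y)) ∧
  Tendsto (fun x => (∫ y in Set.Icc (0:ℝ) x, (1 - F (x - y)) * (1 - F y)) / (1 - F x))
    atTop (nhds (2 * ∫ y in Set.Ioi (0:ℝ), (1 - F y)))

/-- `G_c(x) = F̄_s(x)` for `x ≥ 0` and `G_c(x) = c` for `x < 0`. -/
def Gfun (F : ℝ → ℝ) (c x : ℝ) : ℝ := if 0 ≤ x then tailFs F x else c

/-- `Ĝ_c(x) = min (G_c(x), c)`. -/
def Ghat (F : ℝ → ℝ) (c x : ℝ) : ℝ := min (Gfun F c x) c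

theorem integrableOn_Ioi_tail {F : ℝ → ℝ} (hmono : Monotone F)
    (hint : IntegrableOn (fun u => 1 - F u) (Set.Ioi (0:ℝ))) (a : ℝ) :
    IntegrableOn (fun u => 1 - F u) (Set.Ioi a) := by
  have hanti : Antitone (fun u => 1 - F u) := fun u v h => sub_le_sub_left (hmono h) 1
  have hloc : IntegrableOn (fun u => 1 - F u) (Set.Icc a 0) :=
    (hanti.antitoneOn _).integrableOn_isCompact isCompact_Icc
  refine (hloc.union hint).mono_set fun u hu => ?_
  rcases le_or_gt u 0 with h | h
  · exact Or.inl ⟨le_of_lt hu, h⟩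
  · exact Or.inr h

theorem tailFs_sub_tailFs_add {F : ℝ → ℝ} (hmono : Monotone F)
    (hint : IntegrableOn (fun u => 1 - F u) (Set.Ioi (0:ℝ))) {x t : ℝ} :
    tailFs F x - tailFs F (x + t) = ∫ u in x..(x + t), (1 - F u) :=
  intervalIntegral.integral_Ioi_sub_Ioi' (integrableOn_Ioi_tail hmono hint _)
    (integrableOn_Ioi_tail hmono hint _)

theorem mul_tail_le_tailFs_sub {F : ℝ → ℝ} (hmono : Monotone F)
    (hint : IntegrableOn (fun u => 1 - F u) (Set.Ioi (0:ℝ))) {x t : ℝ} (ht : 0 ≤ t) :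
    t * (1 - F (x + t)) ≤ tailFs F x - tailFs F (x + t) := by
  have hanti : Antitone (fun u => 1 - F u) := fun u v h => sub_le_sub_left (hmono h) 1
  rw [tailFs_sub_tailFs_add hmono hint]
  have h := intervalIntegral.integral_mono_on (μ := volume) (le_add_of_nonneg_right ht : x ≤ x + t)
    intervalIntegrable_const hanti.intervalIntegrable (fun u hu => hanti hu.2)
  rwa [intervalIntegral.integral_const, add_sub_cancel_left, smul_eq_mul] at h

theorem tailFs_sub_le_mul_tail {F : ℝ → ℝ} (hmono : Monotone F)
    (hint : IntegrableOn (fun u => 1 - F u) (Set.Ioi (0:ℝ))) {x t : ℝ} (ht : 0 ≤ t) :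
    tailFs F x - tailFs F (x + t) ≤ t * (1 - F x) := by
  have hanti : Antitone (fun u => 1 - F u) := fun u v h => sub_le_sub_left (hmono h) 1
  rw [tailFs_sub_tailFs_add hmono hint]
  have h := intervalIntegral.integral_mono_on (μ := volume) (le_add_of_nonneg_right ht : x ≤ x + t)
    hanti.intervalIntegrable intervalIntegrable_const (fun u hu => hanti hu.1)
  rwa [intervalIntegral.integral_const, add_sub_cancel_left, smul_eq_mul] at h

theorem antitone_tailFs {F : ℝ → ℝ} (hmono : Monotone F) (hpos : ∀ x, 0 < 1 - F x)
    (hint : IntegrableOn (fun u => 1 - F u) (Set.Ioi (0:ℝ))) : Antitone (tailFs F) := by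
  intro x y hxy
  have h := mul_tail_le_tailFs_sub hmono hint (x := x) (sub_nonneg.2 hxy)
  rw [add_sub_cancel] at h
  have := mul_nonneg (sub_nonneg.2 hxy) (hpos y).le
  linarith

theorem tendsto_tailFs_sub_div {F : ℝ → ℝ} (hmono : Monotone F) (hlong : LongTailed F)
    (hint : IntegrableOn (fun u => 1 - F u) (Set.Ioi (0:ℝ))) {t : ℝ} (ht : 0 ≤ t) :
    Tendsto (fun x => (tailFs F x - tailFs F (x + t)) / (1 - F x)) atTop (nhds t) := by
  have hlow : Tendsto (fun x => t * ((1 - F (x + t)) / (1 - F x))) atTop (nhds t) := by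
    simpa using (hlong.2 t).const_mul t
  refine tendsto_of_tendsto_of_tendsto_of_le_of_le hlow tendsto_const_nhds (fun x => ?_)
    fun x => ?_
  · rw [← mul_div_assoc]
    exact div_le_div_of_nonneg_right (mul_tail_le_tailFs_sub hmono hint ht) (hlong.1 x).le
  · exact (div_le_iff₀ (hlong.1 x)).2 (tailFs_sub_le_mul_tail hmono hint ht)

theorem stmt11 {Ω : Type*} [MeasureSpace Ω] [IsProbabilityMeasure (ℙ : Measure Ω)]
    (F : ℝ → ℝ) (hmono : Monotone F)
    (hrc : ∀ x, ContinuousWithinAt F (Set.Ici x) x)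
    (hbot : Tendsto F atBot (nhds 0)) (htop : Tendsto F atTop (nhds 1))
    (hlong : LongTailed F)
    (hIntTail : IntegrableOn (fun u => 1 - F u) (Set.Ioi (0:ℝ)))
    (T : Ω → ℝ) (hTm : Measurable T) (hT0 : ∀ᵐ ω ∂ℙ, T ω ≤ 0)
    (hTint : Integrable T ℙ) :
    Tendsto (fun x => (tailFs F x - ∫ ω, tailFs F (x - T ω) ∂ℙ) / (1 - F x))
      atTop (nhds (∫ ω, -T ω ∂ℙ)) := by
  have hmeas : Measurable (tailFs F) := (antitone_tailFs hmono hlong.1 hIntTail).measurable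
  have hmeas' : ∀ x, Measurable fun ω => tailFs F x - tailFs F (x - T ω) := fun x =>
    measurable_const.sub (hmeas.comp (measurable_const.sub hTm))
  have hbound : ∀ x, ∀ᵐ ω ∂ℙ,
      ‖(tailFs F x - tailFs F (x - T ω)) / (1 - F x)‖ ≤ -T ω := by
    intro x
    filter_upwards [hT0] with ω hω
    have ht : 0 ≤ -T ω := neg_nonneg.2 hω
    have hup := tailFs_sub_le_mul_tail hmono hIntTail (x := x) ht
    have hlow := antitone_tailFs hmono hlong.1 hIntTail (le_add_of_nonneg_right ht : x ≤ x + -T ω)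
    rw [← sub_eq_add_neg] at hup hlow
    rw [Real.norm_of_nonneg (div_nonneg (sub_nonneg.2 hlow) (hlong.1 x).le)]
    exact (div_le_iff₀ (hlong.1 x)).2 hup
  have hratio : ∀ x, Integrable (fun ω => (tailFs F x - tailFs F (x - T ω)) / (1 - F x)) ℙ :=
    fun x => hTint.neg.mono' ((hmeas' x).div_const _).aestronglyMeasurable (hbound x)
  have hdiff : ∀ x, Integrable (fun ω => tailFs F x - tailFs F (x - T ω)) ℙ := fun x => by
    simpa [div_mul_cancel₀ _ (hlong.1 x).ne'] using (hratio x).mul_const (1 - F x)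
  have htail : ∀ x, Integrable (fun ω => tailFs F (x - T ω)) ℙ := fun x => by
    simpa [Pi.sub_def] using (integrable_const (tailFs F x)).sub (hdiff x)
  have heq : ∀ x, (tailFs F x - ∫ ω, tailFs F (x - T ω) ∂ℙ) / (1 - F x) =
      ∫ ω, (tailFs F x - tailFs F (x - T ω)) / (1 - F x) ∂ℙ := fun x => by
    rw [integral_div, integral_sub (integrable_const _) (htail x)]
    simp
  simp_rw [heq]
  refine tendsto_integral_filter_of_dominated_convergence (fun ω => -T ω)
    (Eventually.of_forall fun x => (hratio x).aestronglyMeasurable)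
    (Eventually.of_forall hbound) hTint.neg ?_
  filter_upwards [hT0] with ω hω
  simpa only [sub_eq_add_neg] using
    tendsto_tailFs_sub_div hmono hlong hIntTail (neg_nonneg.2 hω)
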